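/- Let A be the companion matrix of f(x) = (x-1)³(x²+x+1) and B the companion matrix of g(x) = (x+1)(x⁴+x³+x²+x+1), and set T = B·A⁻¹ in GL(5,ℚ). Then T² = I with T ≠ I, B has order 10 and no power of B equals −I, and the hypergeometric group Γ(f,g) = ⟨A,B⟩ is the free product of the subgroup generated by T and the subgroup generated by B: the canonical group homomorphism from the abstract free product (ℤ/2ℤ) ∗ (ℤ/10ℤ) to GL(5,ℚ) sending the generator of ℤ/2ℤ to T and the generator of ℤ/10ℤ to B is injective with image Γ(f,g). -/

import Mathlib

open Polynomial Matrix

/-- The companion matrix of a monic degree-5 rational polynomial `p`: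
the `5 × 5` matrix whose entries in position `(i+1, i)` equal `1` for
`i = 1, ..., 4`, whose last column is `(-p₀, -p₁, -p₂, -p₃, -p₄)ᵀ`
(where `pᵢ` is the coefficient of `xⁱ` in `p`), and whose remaining
entries are `0`. -/
def companionMatrix (p : ℚ[X]) : Matrix (Fin 5) (Fin 5) ℚ :=
  Matrix.of fun i j : Fin 5 =>
    if (j : ℕ) = 4 then -p.coeff i
    else if (i : ℕ) = (j : ℕ) + 1 then 1 else 0

section FreeProduct

variable {G : Type*} [Group G]

/-- The injectivity of a homomorphism from a free product of two groups can be checked on the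
corresponding free product indexed by `Bool`. -/
theorem coprod_lift_injective_of_coprodI_lift_injective {H : Bool → Type*} [∀ i, Group (H i)]
    (f : ∀ i, H i →* G) (hf : Function.Injective (Monoid.CoprodI.lift f)) :
    Function.Injective (Monoid.Coprod.lift (f false) (f true)) := by
  let θ : Monoid.Coprod (H false) (H true) →* Monoid.CoprodI H :=
    Monoid.Coprod.lift Monoid.CoprodI.of Monoid.CoprodI.of
  let η : Monoid.CoprodI H →* Monoid.Coprod (H false) (H true) :=
    Monoid.CoprodI.lift fun i => match i with
      | false => Monoid.Coprod.inl
      | true => Monoid.Coprod.inr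
  have hηθ : η.comp θ = MonoidHom.id _ := by
    apply Monoid.Coprod.hom_ext <;> ext x <;> simp [θ, η]
  have hθ : Function.Injective θ :=
    Function.LeftInverse.injective (g := η) fun x => DFunLike.congr_fun hηθ x
  have hcomp : Monoid.Coprod.lift (f false) (f true) = (Monoid.CoprodI.lift f).comp θ := by
    apply Monoid.Coprod.hom_ext <;> ext x <;> simp [θ]
  rw [hcomp]
  exact hf.comp hθ

/-- The homomorphism from the cyclic group of order `n` sending the generator to `g`. -/
def zmodPowHom (n : ℕ) (g : G) (hg : g ^ n = 1) : Multiplicative (ZMod n) →* G :=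
  AddMonoidHom.toMultiplicativeLeft <| ZMod.lift n
    ⟨zmultiplesHom (Additive G) (Additive.ofMul g), by
      simp [← ofMul_pow, hg]⟩

theorem zmodPowHom_ofAdd_natCast (n : ℕ) (g : G) (hg : g ^ n = 1) (k : ℕ) :
    zmodPowHom n g hg (Multiplicative.ofAdd (k : ZMod n)) = g ^ k := by
  have h := ZMod.lift_coe n ⟨zmultiplesHom (Additive G) (Additive.ofMul g), by
      simp [← ofMul_pow, hg]⟩ (k : ℤ)
  simp only [Int.cast_natCast] at h
  simp [zmodPowHom, h]

theorem zmodPowHom_ofAdd_one (n : ℕ) (g : G) (hg : g ^ n = 1) :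
    zmodPowHom n g hg (Multiplicative.ofAdd (1 : ZMod n)) = g := by
  simpa using zmodPowHom_ofAdd_natCast n g hg 1

theorem range_zmodPowHom (n : ℕ) (g : G) (hg : g ^ n = 1) :
    (zmodPowHom n g hg).range = Subgroup.zpowers g := by
  apply le_antisymm
  · rintro _ ⟨x, rfl⟩
    obtain ⟨k, hk⟩ := ZMod.intCast_surjective (Multiplicative.toAdd x)
    have hx : x = Multiplicative.ofAdd (1 : ZMod n) ^ k := by
      rw [← ofAdd_zsmul, zsmul_one, hk, ofAdd_toAdd]
    rw [hx, map_zpow, zmodPowHom_ofAdd_one]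
    exact Subgroup.zpow_mem_zpowers g k
  · rw [Subgroup.zpowers_le]
    exact ⟨_, zmodPowHom_ofAdd_one n g hg⟩

open scoped Pointwise in
/-- The ping-pong lemma for an involution `a` and an element `b` of finite order `n`. -/
theorem coprod_lift_zmodPowHom_injective {α : Type*} [MulAction G α] {n : ℕ} (hn : 3 ≤ n)
    {a b : G} (ha : a ^ 2 = 1) (hb : b ^ n = 1) (X Y : Set α) (hX : X.Nonempty) (hY : Y.Nonempty)
    (hXY : Disjoint X Y) (haY : ∀ y ∈ Y, a • y ∈ X)
    (hbX : ∀ k, 0 < k → k < n → ∀ x ∈ X, b ^ k • x ∈ Y) :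
    Function.Injective (Monoid.Coprod.lift (zmodPowHom 2 a ha) (zmodPowHom n b hb)) := by
  have : NeZero n := ⟨by omega⟩
  let o : Bool → ℕ := fun i => cond i n 2
  let f : ∀ i, Multiplicative (ZMod (o i)) →* G := fun i => match i with
    | false => zmodPowHom 2 a ha
    | true => zmodPowHom n b hb
  refine coprod_lift_injective_of_coprodI_lift_injective f ?_
  refine Monoid.CoprodI.lift_injective_of_ping_pong f (Or.inr ⟨true, ?_⟩)
    (fun i => cond i Y X) ?_ ?_ ?_
  · change (3 : Cardinal) ≤ Cardinal.mk (ZMod n)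
    rw [Cardinal.mk_fintype, ZMod.card]
    exact_mod_cast hn
  · rintro (_ | _)
    exacts [hX, hY]
  · rintro (_ | _) (_ | _) hij
    exacts [(hij rfl).elim, hXY, hXY.symm, (hij rfl).elim]
  · have key : ∀ (m : ℕ) [NeZero m] (g : G) (hg : g ^ m = 1) (S S' : Set α),
        (∀ k, 0 < k → k < m → ∀ x ∈ S, g ^ k • x ∈ S') →
        ∀ h : Multiplicative (ZMod m), h ≠ 1 → zmodPowHom m g hg h • S ⊆ S' := by
      intro m _ g hg S S' hS h hh
      rintro _ ⟨x, hx, rfl⟩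
      have hval : h = Multiplicative.ofAdd (((Multiplicative.toAdd h).val : ℕ) : ZMod m) := by
        rw [ZMod.natCast_zmod_val]; rfl
      have hpos : 0 < (Multiplicative.toAdd h).val := by
        rw [Nat.pos_iff_ne_zero, Ne, ZMod.val_eq_zero]
        exact hh
      change zmodPowHom m g hg h • x ∈ S'
      rw [hval, zmodPowHom_ofAdd_natCast]
      exact hS _ hpos (ZMod.val_lt _) x hx
    rintro (_ | _) (_ | _) hij
    · exact (hij rfl).elim
    · refine key 2 a ha Y X fun k hk hk2 y hy => ?_
      obtain rfl : k = 1 := by omega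
      simpa using haY y hy
    · exact key n b hb X Y hbX
    · exact (hij rfl).elim

end FreeProduct

namespace HyperbolicPingPong

/-- The companion matrix of `f = (X - 1) ^ 3 * (X ^ 2 + X + 1)`. -/
def matA : Matrix (Fin 5) (Fin 5) ℚ :=
  !![0, 0, 0, 0, 1; 1, 0, 0, 0, -2; 0, 1, 0, 0, 1; 0, 0, 1, 0, -1; 0, 0, 0, 1, 2]

/-- The companion matrix of `g = (X + 1) * (X ^ 4 + X ^ 3 + X ^ 2 + X + 1)`. -/
def matB : Matrix (Fin 5) (Fin 5) ℚ :=
  !![0, 0, 0, 0, -1; 1, 0, 0, 0, -2; 0, 1, 0, 0, -2; 0, 0, 1, 0, -2; 0, 0, 0, 1, -2]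

/-- The product of `matB` with the inverse of `matA`. -/
def matT : Matrix (Fin 5) (Fin 5) ℚ :=
  !![-1, 0, 0, 0, 0; 0, 1, 0, 0, 0; -3, 0, 1, 0, 0; -1, 0, 0, 1, 0; -4, 0, 0, 0, 1]

/-- The Gram matrix of an invariant quadratic form of signature `(1, 4)`. -/
def gram : Matrix (Fin 5) (Fin 5) ℚ :=
  !![-11, 3, 5, -5, 13; 3, -11, 3, 5, -5; 5, 3, -11, 3, 5; -5, 5, 3, -11, 3; 13, -5, 5, 3, -11]

/-- The invariant bilinear form. -/
def form (x y : Fin 5 → ℚ) : ℚ := x ⬝ᵥ (gram *ᵥ y)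

/-- The `-1`-eigenvector of `matT`; it represents a point of hyperbolic space. -/
def center : Fin 5 → ℚ := ![2, 0, 3, 1, 4]

/-- Normal vectors of the walls of the ping-pong domain. The middle seven walls bisect the segments
from `center` to its images under powers of `-matB`; the outer two contain the fixed points at
infinity of the parabolic isometries `matT * matB⁻¹` and `matT * matB`. -/
def wall : Fin 9 → Fin 5 → ℚ :=
  ![![1, 3, 3, 2, 1], ![1, 2, 1, 1, 1], ![7, 11, 5, 9, 8], ![2, 3, 2, 3, 2], ![6, 8, 5, 7, 4],
    ![2, 2, 1, 2, 1], ![7, 6, 5, 9, 3], ![1, 1, 1, 1, 0], ![1, 1, 0, -1, -1]]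

theorem form_add_right (x y z : Fin 5 → ℚ) : form x (y + z) = form x y + form x z := by
  simp [form, mulVec_add, dotProduct_add]

theorem form_smul_right (c : ℚ) (x y : Fin 5 → ℚ) : form x (c • y) = c * form x y := by
  simp [form, mulVec_smul, dotProduct_smul]

theorem form_comm (x y : Fin 5 → ℚ) : form x y = form y x := by
  have h : gramᵀ = gram := by decide +kernel
  rw [form, dotProduct_mulVec, ← mulVec_transpose, h, dotProduct_comm, form]

theorem form_mulVec_mulVec {M : Matrix (Fin 5) (Fin 5) ℚ} (hM : Mᵀ * gram * M = gram)
    (x y : Fin 5 → ℚ) : form (M *ᵥ x) (M *ᵥ y) = form x y := by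
  conv_rhs => rw [form, ← hM]
  rw [form, ← vecMul_transpose, ← dotProduct_mulVec]
  simp only [mulVec_mulVec, Matrix.mul_assoc]

theorem gram_invariant_pow {M : Matrix (Fin 5) (Fin 5) ℚ} (hM : Mᵀ * gram * M = gram) (k : ℕ) :
    (M ^ k)ᵀ * gram * M ^ k = gram := by
  induction k with
  | zero => simp
  | succ k ih =>
    calc (M ^ (k + 1))ᵀ * gram * M ^ (k + 1) = Mᵀ * ((M ^ k)ᵀ * gram * M ^ k) * M := by
          rw [pow_succ, transpose_mul]; simp only [Matrix.mul_assoc]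
      _ = gram := by rw [ih, hM]

/-- The form is negative semidefinite on the orthogonal complement of `center`. -/
theorem form_self_nonpos {z : Fin 5 → ℚ} (hz : form z center = 0) : form z z ≤ 0 := by
  simp only [form, gram, center, dotProduct, mulVec, Fin.sum_univ_five, Matrix.of_apply,
    Matrix.cons_val] at hz ⊢
  have hz0 : z 0 = 0 := by linarith
  rw [hz0]
  nlinarith [sq_nonneg (11 * z 1 - 3 * z 2 - 5 * z 3 + 5 * z 4),
    sq_nonneg (14 * z 2 - 6 * z 3 - 5 * z 4), sq_nonneg (3 * z 3 - z 4), sq_nonneg (z 4)]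

/-- A timelike vector and a causal vector in the future of `center` pair with the sign given by the
time orientation. -/
theorem form_center_mul_form_pos {x y : Fin 5 → ℚ} (hx : 0 < form x x) (hy : 0 ≤ form y y)
    (hyc : 0 < form y center) : 0 < form x center * form x y := by
  set z := form y center • x + (-form x center) • y with hz
  have hright (w : Fin 5 → ℚ) : form w z = form y center * form w x - form x center * form w y := by
    rw [hz, form_add_right, form_smul_right, form_smul_right]
    ring
  have expand : form z z =
      form y center ^ 2 * form x x - 2 * (form y center * (form x center * form x y))
        + form x center ^ 2 * form y y := by
    rw [hright, form_comm z x, form_comm z y, hright, hright, form_comm y x]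
    ring
  have orth : form z center = 0 := by
    rw [form_comm, hright, form_comm center x, form_comm center y]
    ring
  have h := form_self_nonpos orth
  rw [expand] at h
  have h₁ : 0 < form y center ^ 2 * form x x := by positivity
  have h₂ : 0 ≤ form x center ^ 2 * form y y := by positivity
  exact pos_of_mul_pos_right (by linarith : 0 < form y center * (form x center * form x y)) hyc.le

theorem matB_invariant : matBᵀ * gram * matB = gram := by decide +kernel

theorem matT_invariant : matTᵀ * gram * matT = gram := by decide +kernel

theorem matT_mul_matT : matT * matT = 1 := by decide +kernel

theorem matB_pow_ten : matB ^ 10 = 1 := by decide +kernel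

theorem matT_mul_matA : matT * matA = matB := by decide +kernel

theorem matT_mulVec_center : matT *ᵥ center = (-1 : ℚ) • center := by decide +kernel

theorem matB_pow_mulVec_wall_rev (i : Fin 9) :
    matB ^ (i + 1 : ℕ) *ᵥ wall i.rev = (-1 : ℚ) ^ (i : ℕ) • wall i := by
  revert i; decide +kernel

theorem form_matB_pow_center_pos (i : Fin 9) :
    0 < form ((-1 : ℚ) ^ (i + 1 : ℕ) • matB ^ (9 - i : ℕ) *ᵥ center) center := by
  revert i; decide +kernel

theorem form_matB_pow_center_self_nonneg (i : Fin 9) :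
    0 ≤ form ((-1 : ℚ) ^ (i + 1 : ℕ) • matB ^ (9 - i : ℕ) *ᵥ center)
      ((-1 : ℚ) ^ (i + 1 : ℕ) • matB ^ (9 - i : ℕ) *ᵥ center) := by
  revert i; decide +kernel

theorem form_wall_self_neg (i : Fin 9) : form (wall i) (wall i) < 0 := by
  revert i; decide +kernel

theorem form_center_wall_pos (i : Fin 9) : 0 < form center (wall i) := by
  revert i; decide +kernel

/-- The reflection `-matT` of the wall `j`, projected along the wall `i` to its orthogonal
complement (and rescaled). -/
def projectedWall (i j : Fin 9) : Fin 5 → ℚ :=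
  form (wall i) (wall i) • matT *ᵥ wall j + (-form (wall i) (matT *ᵥ wall j)) • wall i

theorem form_wall_matT_wall_neg (i j : Fin 9) : form (wall i) (matT *ᵥ wall j) < 0 := by
  revert i j; decide +kernel

theorem projectedWall_causal (i j : Fin 9) :
    0 ≤ form (projectedWall i j) (projectedWall i j) := by
  revert i j; decide +kernel

theorem projectedWall_future (i j : Fin 9) : 0 < form (projectedWall i j) center := by
  revert i j; decide +kernel

/-- The timelike vectors lying, up to sign, on the side of `center` of all walls. -/
def inside : Set (Fin 5 → ℚ) :=
  {x | 0 < form x x ∧ ∀ i, 0 < form x center * form x (wall i)}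

/-- The timelike vectors separated, up to sign, from `center` by some wall. -/
def outside : Set (Fin 5 → ℚ) :=
  {x | 0 < form x x ∧ ∃ i, form x center * form x (wall i) < 0}

theorem disjoint_inside_outside : Disjoint inside outside := by
  rw [Set.disjoint_left]
  rintro x ⟨-, hx⟩ ⟨-, i, hi⟩
  exact (hx i).not_gt hi

theorem center_mem_inside : center ∈ inside := by
  have h : 0 < form center center := by decide +kernel
  exact ⟨h, fun i => mul_pos h (form_center_wall_pos i)⟩

theorem matB_pow_mulVec_mem_outside {x : Fin 5 → ℚ} (hx : x ∈ inside) {k : ℕ} (hk : 0 < k)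
    (hk10 : k < 10) : matB ^ k *ᵥ x ∈ outside := by
  obtain ⟨i, rfl⟩ : ∃ i : Fin 9, k = i + 1 := ⟨⟨k - 1, by omega⟩, by simp; omega⟩
  have hinv := form_mulVec_mulVec (gram_invariant_pow matB_invariant (i + 1))
  refine ⟨by rw [hinv]; exact hx.1, i, ?_⟩
  set s : ℚ := (-1) ^ (i : ℕ) with hs
  have hss : s * s = 1 := by rw [hs, ← mul_pow]; simp
  have hwall : form (matB ^ (i + 1 : ℕ) *ᵥ x) (wall i) = s * form x (wall i.rev) := by
    rw [← hinv x, matB_pow_mulVec_wall_rev, form_smul_right, ← mul_assoc, hss, one_mul]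
  have hcenter : 0 < form x center * (-s * form (matB ^ (i + 1 : ℕ) *ᵥ x) center) := by
    have h := form_center_mul_form_pos hx.1 (form_matB_pow_center_self_nonneg i)
      (form_matB_pow_center_pos i)
    rw [form_smul_right, ← hinv x (matB ^ (9 - i : ℕ) *ᵥ center), mulVec_mulVec, ← pow_add,
      show (i + 1 + (9 - i) : ℕ) = 10 by omega, matB_pow_ten, one_mulVec, pow_succ] at h
    simpa using h
  rw [hwall]
  have h := mul_pos hcenter (hx.2 i.rev)
  have hne : 0 < form x center ^ 2 := by
    have : form x center ≠ 0 := left_ne_zero_of_mul hcenter.ne'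
    positivity
  refine neg_of_mul_neg_right (a := form x center ^ 2) ?_ hne.le
  linarith

theorem matT_mulVec_mem_inside {x : Fin 5 → ℚ} (hx : x ∈ outside) : matT *ᵥ x ∈ inside := by
  have hinv := form_mulVec_mulVec matT_invariant
  have hT (y : Fin 5 → ℚ) : form (matT *ᵥ x) y = form x (matT *ᵥ y) := by
    rw [← hinv x, mulVec_mulVec, matT_mul_matT, one_mulVec]
  obtain ⟨hxx, i, hi⟩ := hx
  refine ⟨by rwa [hinv], fun j => ?_⟩
  have h := form_center_mul_form_pos hxx (projectedWall_causal i j) (projectedWall_future i j)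
  rw [projectedWall, form_add_right, form_smul_right, form_smul_right] at h
  rw [hT, hT, matT_mulVec_center, form_smul_right]
  have h₁ := mul_neg_of_pos_of_neg (neg_pos.2 (form_wall_matT_wall_neg i j)) hi
  refine pos_of_mul_pos_right (a := -form (wall i) (wall i)) ?_
    (neg_pos.2 (form_wall_self_neg i)).le
  linarith

theorem companionMatrix_f : companionMatrix ((X - 1) ^ 3 * (X ^ 2 + X + 1)) = matA := by
  have h : ((X - 1) ^ 3 * (X ^ 2 + X + 1) : ℚ[X]) =
      X ^ 5 + C (-2) * X ^ 4 + C 1 * X ^ 3 + C (-1) * X ^ 2 + C 2 * X + C (-1) := by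
    simp only [map_neg, map_one, map_ofNat]
    ring
  rw [h]
  ext i j
  fin_cases i <;> fin_cases j <;>
    simp [companionMatrix, matA, coeff_X, coeff_C, coeff_X_pow, -map_neg]

theorem companionMatrix_g :
    companionMatrix ((X + 1) * (X ^ 4 + X ^ 3 + X ^ 2 + X + 1)) = matB := by
  have h : ((X + 1) * (X ^ 4 + X ^ 3 + X ^ 2 + X + 1) : ℚ[X]) =
      X ^ 5 + C 2 * X ^ 4 + C 2 * X ^ 3 + C 2 * X ^ 2 + C 2 * X + C 1 := by
    simp only [map_one, map_ofNat]
    ring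
  rw [h]
  ext i j
  fin_cases i <;> fin_cases j <;>
    simp [companionMatrix, matB, coeff_X, coeff_X_pow, coeff_one]

/-- The action of the general linear group on column vectors. -/
abbrev mulVecAction : MulAction (GL (Fin 5) ℚ) (Fin 5 → ℚ) where
  smul g x := (g : Matrix (Fin 5) (Fin 5) ℚ) *ᵥ x
  one_smul := one_mulVec
  mul_smul g h x := (mulVec_mulVec x (g : Matrix (Fin 5) (Fin 5) ℚ) h).symm

end HyperbolicPingPong

open HyperbolicPingPong in

/-- `Γ(f,g) = ⟨T⟩ ∗ ⟨B⟩` for `f = ((X - 1) ^ 3 * (X ^ 2 + X + 1))`, `g = ((X + 1) * (X ^ 4 + X ^ 3 + X ^ 2 + X + 1))`. -/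
theorem hypergeometric_free_product_case14 (A B T : GL (Fin 5) ℚ)
    (hA : (↑A : Matrix (Fin 5) (Fin 5) ℚ) = companionMatrix ((X - 1) ^ 3 * (X ^ 2 + X + 1)))
    (hB : (↑B : Matrix (Fin 5) (Fin 5) ℚ) = companionMatrix ((X + 1) * (X ^ 4 + X ^ 3 + X ^ 2 + X + 1)))
    (hT : T = B * A⁻¹) :
    T ^ 2 = 1 ∧ T ≠ 1 ∧ orderOf B = 10 ∧ (∀ i : ℤ, B ^ i ≠ -1) ∧
    ∃ φ : Monoid.Coprod (Multiplicative (ZMod 2)) (Multiplicative (ZMod 10)) →* GL (Fin 5) ℚ,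
      φ (Monoid.Coprod.inl (Multiplicative.ofAdd (1 : ZMod 2))) = T ∧
      φ (Monoid.Coprod.inr (Multiplicative.ofAdd (1 : ZMod 10))) = B ∧
      Function.Injective φ ∧
      φ.range = Subgroup.closure {A, B} := by
  rw [companionMatrix_f] at hA
  rw [companionMatrix_g] at hB
  have hTA : T * A = B := by rw [hT, inv_mul_cancel_right]
  have hT' : (T : Matrix (Fin 5) (Fin 5) ℚ) = matT := by
    apply A.isUnit.mul_right_cancel
    rw [← Units.val_mul, hTA, hA, hB, matT_mul_matA]
  have hBpow (k : ℕ) : ((B ^ k : GL (Fin 5) ℚ) : Matrix (Fin 5) (Fin 5) ℚ) = matB ^ k := by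
    rw [Units.val_pow_eq_pow_val, hB]
  have hT2 : T ^ 2 = 1 := by
    ext1
    rw [Units.val_pow_eq_pow_val, hT', sq, matT_mul_matT, Units.val_one]
  have hB10 : B ^ 10 = 1 := by
    ext1
    rw [hBpow, matB_pow_ten, Units.val_one]
  have hBne (k : ℕ) (hk : k < 10) (hk0 : 0 < k) : B ^ k ≠ 1 := by
    intro h
    refine Set.disjoint_left.1 disjoint_inside_outside center_mem_inside ?_
    have := matB_pow_mulVec_mem_outside center_mem_inside hk0 hk
    rwa [← hBpow, h, Units.val_one, one_mulVec] at this
  refine ⟨hT2, ?_, ?_, ?_, ?_⟩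
  · rintro rfl
    rw [Units.val_one] at hT'
    exact absurd hT' (by decide +kernel)
  · exact (orderOf_eq_iff (by norm_num)).2 ⟨hB10, hBne⟩
  · intro i h
    have hmod : B ^ i = B ^ (i % 10).toNat := by
      rw [← zpow_natCast, Int.toNat_of_nonneg (Int.emod_nonneg _ (by norm_num))]
      conv_lhs => rw [← Int.mul_ediv_add_emod i 10, _root_.zpow_add, _root_.zpow_mul]
      rw [show B ^ (10 : ℤ) = 1 from mod_cast hB10, _root_.one_zpow, one_mul]
    have hlt : (i % 10).toNat < 10 := by omega
    have hne : ∀ k : Fin 10, matB ^ (k : ℕ) ≠ -1 := by decide +kernel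
    refine hne ⟨_, hlt⟩ ?_
    rw [← hBpow, ← hmod, h, Units.val_neg, Units.val_one]
  · let _ := mulVecAction
    refine ⟨Monoid.Coprod.lift (zmodPowHom 2 T hT2) (zmodPowHom 10 B hB10), ?_, ?_, ?_, ?_⟩
    · rw [Monoid.Coprod.lift_apply_inl, zmodPowHom_ofAdd_one]
    · rw [Monoid.Coprod.lift_apply_inr, zmodPowHom_ofAdd_one]
    · refine coprod_lift_zmodPowHom_injective (by norm_num) hT2 hB10 inside outside
        ⟨_, center_mem_inside⟩
        ⟨_, matB_pow_mulVec_mem_outside center_mem_inside one_pos (by norm_num)⟩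
        disjoint_inside_outside (fun y hy => ?_) fun k hk hk10 x hx => ?_
      · change (T : Matrix (Fin 5) (Fin 5) ℚ) *ᵥ y ∈ inside
        rw [hT']
        exact matT_mulVec_mem_inside hy
      · change ((B ^ k : GL (Fin 5) ℚ) : Matrix (Fin 5) (Fin 5) ℚ) *ᵥ x ∈ outside
        rw [hBpow]
        exact matB_pow_mulVec_mem_outside hx hk hk10
    · rw [Monoid.Coprod.range_lift, range_zmodPowHom, range_zmodPowHom,
        Subgroup.zpowers_eq_closure, Subgroup.zpowers_eq_closure, ← Subgroup.closure_union]
      apply le_antisymm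
      · rw [Subgroup.closure_le]
        have hAmem : A ∈ Subgroup.closure {A, B} := Subgroup.subset_closure (by simp)
        have hBmem : B ∈ Subgroup.closure {A, B} := Subgroup.subset_closure (by simp)
        rintro _ (rfl | rfl)
        · rw [hT]
          exact mul_mem hBmem (inv_mem hAmem)
        · exact hBmem
      · rw [Subgroup.closure_le]
        have hTmem : T ∈ Subgroup.closure ({T} ∪ {B}) := Subgroup.subset_closure (by simp)
        have hBmem : B ∈ Subgroup.closure ({T} ∪ {B}) := Subgroup.subset_closure (by simp)
        have hAeq : A = T⁻¹ * B := eq_inv_mul_of_mul_eq hTA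
        rintro _ (rfl | rfl)
        · rw [hAeq]
          exact mul_mem (inv_mem hTmem) hBmem
        · exact hBmem
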